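/- Let n ≥ 2 be an integer and v > 0 a real number. Suppose γ_0, γ_1, …, γ_n ∈ Φ(n,v) and there exist indices p ≠ q in {0,…,n} and an integer k such that γ_p = α_0 and γ_q = c_k α_0 + c_{k+1}(α_1 + α_2 + ⋯ + α_n). Then det(γ_0, γ_1, …, γ_n) = 0, or there exist ε ∈ {1,−1}, an integer l, an integer m ≥ 1, and positive integers h_1,…,h_m such that det(γ_0, γ_1, …, γ_n) = ε · v^l · (v − v^{−1})^{m−1} · ∏_{k=1}^m c_{h_k}. -/

import Mathlib

/-- The quantum integer `c_k`: `(v^k - v^(-k))/(v - v⁻¹)` if `v ≠ 1`, and `k` if `v = 1`. -/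
noncomputable def qint (v : ℝ) (k : ℤ) : ℝ :=
  if v = 1 then (k : ℝ) else (v ^ k - v ^ (-k)) / (v - v⁻¹)

/-- The root `α_{i,j} = α_i + α_{i+1} + ⋯ + α_j` in coordinates. -/
noncomputable def alphaIJ (n i j : ℕ) : Fin (n + 1) → ℝ :=
  fun l => if i ≤ (l : ℕ) ∧ (l : ℕ) ≤ j then 1 else 0

/-- The root `α'_{i,j} = α_0 + v(α_1 + ⋯ + α_{i-1}) + v⁻¹(α_{j+1} + ⋯ + α_n)` in coordinates. -/
noncomputable def alphaIJ' (n : ℕ) (v : ℝ) (i j : ℕ) : Fin (n + 1) → ℝ :=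
  fun l => if (l : ℕ) = 0 then 1
    else if (l : ℕ) < i then v
    else if j < (l : ℕ) then v⁻¹
    else 0

/-- `Φ_{i,j}(n,v) = { η v^m (c_{k+1} α_{i,j} + c_k α'_{i,j}) | η = ±1, m, k ∈ ℤ }`. -/
noncomputable def PhiIJ (n : ℕ) (v : ℝ) (i j : ℕ) : Set (Fin (n + 1) → ℝ) :=
  { x | ∃ (η : ℝ) (m k : ℤ), (η = 1 ∨ η = -1) ∧
      x = (η * v ^ m) • (qint v (k + 1) • alphaIJ n i j + qint v k • alphaIJ' n v i j) }

/-- The realized root system `Φ(n,v)` of affine type `Ã_n` with parameter `v`. -/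
noncomputable def Phi (n : ℕ) (v : ℝ) : Set (Fin (n + 1) → ℝ) :=
  ⋃ (i : ℕ) (j : ℕ) (_ : 1 ≤ i) (_ : i ≤ j) (_ : j ≤ n), PhiIJ n v i j

/-- The determinant of the square matrix whose `l`-th column is `γ l`. -/
noncomputable def detCols {n : ℕ} (γ : Fin n → Fin n → ℝ) : ℝ :=
  Matrix.det (Matrix.of fun i l => γ l i)

theorem qint_mul (v : ℝ) (hv : 0 < v) (h : ℤ) : (v - v⁻¹) * qint v h = v ^ h - v ^ (-h) := by
  unfold qint
  split_ifs with h1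
  · subst h1; simp
  · have : v - v⁻¹ ≠ 0 := by
      intro h0
      field_simp at h0
      have : (v - 1) * (v + 1) = 0 := by linarith
      rcases mul_eq_zero.1 this with h2 | h2
      · exact h1 (by linarith)
      · linarith
    exact mul_div_cancel₀ _ this

theorem qint_neg (v : ℝ) (h : ℤ) : qint v (-h) = - qint v h := by
  unfold qint
  split_ifs with h1
  · push_cast; ring
  · rw [neg_neg]; ring

theorem qint_zero (v : ℝ) : qint v 0 = 0 := by
  unfold qint; simp

theorem qint_succ (v : ℝ) (hv : 0 < v) (k : ℤ) : qint v (k + 1) = v * qint v k + v ^ (-k) := by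
  by_cases h1 : v = 1
  · subst h1; simp [qint]
  · have h0 : v - v⁻¹ ≠ 0 := by
      intro h0
      field_simp at h0
      have : (v - 1) * (v + 1) = 0 := by linarith
      rcases mul_eq_zero.1 this with h2 | h2
      · exact h1 (by linarith)
      · linarith
    apply mul_left_cancel₀ h0
    have e1 := qint_mul v hv (k+1)
    have e2 := qint_mul v hv k
    rw [e1, mul_add, mul_left_comm, e2, neg_add, zpow_add₀ hv.ne', zpow_add₀ hv.ne', zpow_neg_one,
      zpow_one]
    ring

theorem qint_succ' (v : ℝ) (hv : 0 < v) (k : ℤ) : qint v (k + 1) = v⁻¹ * qint v k + v ^ k := by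
  rw [qint_succ v hv]
  have e2 := qint_mul v hv k
  linarith

/-- The multiplicative class of values of determinants. -/
def Good (v x : ℝ) : Prop :=
  x = 0 ∨ ∃ (ε : ℝ) (l : ℤ) (L : List ℤ), (ε = 1 ∨ ε = -1) ∧ (∀ h ∈ L, 0 < h) ∧
    x = ε * v ^ l * (L.map fun h => (v - v⁻¹) * qint v h).prod

theorem Good.mul {v x y : ℝ} (hv : 0 < v) (hx : Good v x) (hy : Good v y) : Good v (x * y) := by
  rcases hx with rfl | ⟨ε, l, L, he, hL, rfl⟩
  · left; simp
  rcases hy with rfl | ⟨ε', l', L', he', hL', rfl⟩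
  · left; simp
  right
  refine ⟨ε * ε', l + l', L ++ L', ?_, ?_, ?_⟩
  · rcases he with rfl | rfl <;> rcases he' with rfl | rfl <;> simp
  · intro h hh
    rcases List.mem_append.1 hh with hh | hh
    · exact hL h hh
    · exact hL' h hh
  · rw [List.map_append, List.prod_append, zpow_add₀ hv.ne']; ring

theorem good_unit (v : ℝ) (ε : ℝ) (he : ε = 1 ∨ ε = -1) (l : ℤ) : Good v (ε * v ^ l) :=
  Or.inr ⟨ε, l, [], he, by simp, by simp⟩

theorem good_zpow (v : ℝ) (l : ℤ) : Good v (v ^ l) := by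
  simpa using good_unit v 1 (Or.inl rfl) l

theorem good_neg_one_pow (v : ℝ) (i : ℕ) : Good v ((-1) ^ i) := by
  simpa using good_unit v ((-1)^i) (neg_one_pow_eq_or ℝ i) 0

theorem good_sub (v : ℝ) (hv : 0 < v) (x y : ℤ) (h : Even (x - y)) : Good v (v ^ x - v ^ y) := by
  obtain ⟨d, hd⟩ := h
  have hx : x = (x - d) + d := by ring
  have hy : y = (x - d) + -d := by omega
  have e : v ^ x - v ^ y = v ^ (x - d) * ((v - v⁻¹) * qint v d) := by
    rw [qint_mul v hv, mul_sub, ← zpow_add₀ hv.ne', ← zpow_add₀ hv.ne', ← hx, ← hy]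
  rw [e]
  rcases lt_trichotomy d 0 with h0 | h0 | h0
  · right
    refine ⟨-1, x - d, [-d], Or.inr rfl, by simpa using h0, ?_⟩
    simp [qint_neg]
  · left; subst h0; simp [qint_zero]
  · right
    exact ⟨1, x - d, [d], Or.inl rfl, by simpa using h0, by simp⟩

/-- Row vectors with at most two entries, of the gain-graph shape. -/
def Row (v : ℝ) {N : ℕ} (r : Fin N → ℝ) : Prop :=
  (∃ (i : Fin N) (s : ℝ), Good v s ∧ r = s • Pi.single i 1) ∨
  (∃ (i j : Fin N) (ε : ℝ) (x y : ℤ), (ε = 1 ∨ ε = -1) ∧ Even (x - y) ∧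
    r = (ε * v ^ x) • Pi.single i 1 - (ε * v ^ y) • Pi.single j 1)

theorem row_B {v : ℝ} (hv : 0 < v) {N M : ℕ} {r : Fin N → ℝ} (hr : Row v r)
    (f : (Fin N → ℝ) →ₗ[ℝ] (Fin M → ℝ))
    (hf : ∀ i, ∃ (a : Fin M) (d : ℤ), Even d ∧ f (Pi.single i 1) = v ^ d • Pi.single a 1) :
    Row v (f r) := by
  rcases hr with ⟨i, s, hs, rfl⟩ | ⟨i, j, ε, x, y, he, hxy, rfl⟩
  · obtain ⟨a, d, hd, h⟩ := hf i
    left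
    exact ⟨a, s * v ^ d, hs.mul hv (good_zpow v d), by rw [map_smul, h, smul_smul]⟩
  · obtain ⟨a, d, hd, h⟩ := hf i
    obtain ⟨b, d', hd', h'⟩ := hf j
    right
    refine ⟨a, b, ε, x + d, y + d', he, ?_, ?_⟩
    · have : x + d - (y + d') = (x - y) + (d - d') := by ring
      rw [this]
      exact hxy.add (hd.sub hd')
    · rw [map_sub, map_smul, map_smul, h, h', smul_smul, smul_smul, zpow_add₀ hv.ne',
        zpow_add₀ hv.ne', mul_assoc, mul_assoc]

theorem good_neg {v x : ℝ} (hv : 0 < v) (h : Good v x) : Good v (-x) := by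
  have := (good_unit v (-1) (Or.inr rfl) 0).mul hv h
  simpa using this

theorem row_A {v : ℝ} (hv : 0 < v) {N M : ℕ} {r : Fin N → ℝ} (hr : Row v r)
    (f : (Fin N → ℝ) →ₗ[ℝ] (Fin M → ℝ)) (z : Fin M)
    (hf : ∀ i, f (Pi.single i 1) = 0 ∨ ∃ a, f (Pi.single i 1) = Pi.single a 1) :
    Row v (f r) := by
  rcases hr with ⟨i, s, hs, rfl⟩ | ⟨i, j, ε, x, y, he, hxy, rfl⟩
  · left
    rcases hf i with h | ⟨a, h⟩
    · exact ⟨z, 0, Or.inl rfl, by rw [map_smul, h]; simp⟩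
    · exact ⟨a, s, hs, by rw [map_smul, h]⟩
  · rw [map_sub, map_smul, map_smul]
    rcases hf i with h | ⟨a, h⟩ <;> rcases hf j with h' | ⟨b, h'⟩ <;> rw [h, h']
    · left; exact ⟨z, 0, Or.inl rfl, by simp⟩
    · left; exact ⟨b, -(ε * v ^ y), good_neg hv (good_unit v ε he y), by rw [neg_smul]; simp⟩
    · left; exact ⟨a, ε * v ^ x, good_unit v ε he x, by simp⟩
    · right; exact ⟨a, b, ε, x, y, he, hxy, rfl⟩

theorem det_pivot {N : ℕ} (A : Matrix (Fin (N+1)) (Fin (N+1)) ℝ) (i : Fin (N+1))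
    (h : ∀ j, j ≠ i → A 0 j = 0) :
    A.det = (-1) ^ (i : ℕ) * A 0 i * (A.submatrix Fin.succ i.succAbove).det := by
  rw [Matrix.det_succ_row_zero, Finset.sum_eq_single i]
  · intro b _ hb; rw [h b hb]; simp
  · simp

/-- Projection that forgets coordinate `i` after adding `c` times it to coordinate `j`. -/
def proj {N : ℕ} (i j : Fin (N+1)) (c : ℝ) : (Fin (N+1) → ℝ) →ₗ[ℝ] (Fin N → ℝ) where
  toFun w := fun b => w (i.succAbove b) + (if i.succAbove b = j then c * w i else 0)
  map_add' x y := by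
    ext b; simp only [Pi.add_apply]; split_ifs <;> ring
  map_smul' a x := by
    ext b; simp only [Pi.smul_apply, smul_eq_mul, RingHom.id_apply]; split_ifs <;> ring

theorem proj_ne {N : ℕ} (i j : Fin (N+1)) (c : ℝ) (a : Fin N) :
    proj i j c (Pi.single (i.succAbove a) 1) = Pi.single a 1 := by
  ext b
  have : i ≠ i.succAbove a := (Fin.succAbove_ne i a).symm
  simp [proj, Pi.single_apply, this]

theorem proj_eq {N : ℕ} (i : Fin (N+1)) (c : ℝ) (a : Fin N) :
    proj i (i.succAbove a) c (Pi.single i 1) = c • Pi.single a 1 := by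
  ext b
  simp [proj, Pi.single_apply, Fin.succAbove_ne]

theorem det_good (v : ℝ) (hv : 0 < v) : ∀ (N : ℕ) (A : Matrix (Fin N) (Fin N) ℝ),
    (∀ l, Row v (A l)) → Good v A.det := by
  intro N
  induction N with
  | zero => intro A _; simpa using good_zpow v 0
  | succ N ih =>
    intro A hA
    have key : (∃ (i : Fin (N+1)) (s : ℝ), Good v s ∧ A 0 = s • Pi.single i 1) ∨
      (∃ (i j : Fin (N+1)) (ε : ℝ) (x y : ℤ), i ≠ j ∧ (ε = 1 ∨ ε = -1) ∧ Even (x - y) ∧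
        A 0 = (ε * v ^ x) • Pi.single i 1 - (ε * v ^ y) • Pi.single j 1) := by
      rcases hA 0 with h | ⟨i, j, ε, x, y, he, hxy, h⟩
      · exact Or.inl h
      · by_cases hij : i = j
        · subst hij
          left
          refine ⟨i, ε * (v ^ x - v ^ y), ?_, ?_⟩
          · exact Good.mul hv (by simpa using good_unit v ε he 0) (good_sub v hv x y hxy)
          · rw [h, ← sub_smul]; congr 1; ring
        · right; exact ⟨i, j, ε, x, y, hij, he, hxy, h⟩
    rcases key with ⟨i, s, hs, h⟩ | ⟨i, j, ε, x, y, hij, he, hxy, h⟩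
    · rw [det_pivot A i (by intro j hj; simp [h, hj])]
      refine Good.mul hv (Good.mul hv (good_neg_one_pow v _) (by simpa [h] using hs)) ?_
      apply ih
      intro l
      have := row_A hv (hA l.succ) (proj i i 0) l (by
        intro a
        rcases Fin.eq_self_or_eq_succAbove i a with rfl | ⟨b, rfl⟩
        · left; ext b; simp [proj, Fin.succAbove_ne]
        · right; exact ⟨b, proj_ne _ _ _ _⟩)
      convert this using 1
      funext b
      simp [proj]
    · have hd := Matrix.det_updateCol_add_smul_self A hij.symm (v ^ (y - x))
      rw [← hd, det_pivot _ i]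
      · refine Good.mul hv (Good.mul hv (good_neg_one_pow v _) ?_) ?_
        · rw [Matrix.updateCol_ne hij]
          have : A 0 i = ε * v ^ x := by simp [h, hij]
          rw [this]
          exact good_unit v ε he x
        · apply ih
          intro l
          obtain ⟨j', hj'⟩ := Fin.exists_succAbove_eq hij.symm
          have := row_B hv (hA l.succ) (proj i j (v ^ (y - x))) (by
            intro a
            rcases Fin.eq_self_or_eq_succAbove i a with rfl | ⟨b, rfl⟩
            · refine ⟨j', y - x, ?_, ?_⟩
              · rw [← neg_sub]; exact hxy.neg
              · rw [← hj']; exact proj_eq _ _ _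
            · exact ⟨b, 0, Even.zero, by rw [proj_ne]; simp⟩)
          convert this using 1
          funext b
          simp only [Matrix.submatrix_apply, Matrix.updateCol_apply, proj]
          simp
          split_ifs with hb
          · rw [hb]
          · simp
      · intro a ha
        rw [Matrix.updateCol_apply]
        split_ifs with hb
        · simp [h, hij, hij.symm]
          rw [zpow_sub₀ hv.ne']
          have := (zpow_pos hv x).ne'
          field_simp
          ring
        · simp [h, ha, hb]

/-- Upper triangular all-ones matrix. -/
def chiM (n : ℕ) : Matrix (Fin (n+1)) (Fin (n+1)) ℝ := Matrix.of fun a b => if a ≤ b then 1 else 0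

theorem det_chiM (n : ℕ) : (chiM n).det = 1 := by
  rw [Matrix.det_of_isUpperTriangular]
  · simp [chiM]
  · intro i j hij
    simp only [chiM, Matrix.of_apply]
    rw [if_neg]
    exact not_le.2 hij

/-- The indicator vector of coordinates `≥ a`. -/
def chi (n : ℕ) (a : ℕ) : Fin (n+1) → ℝ := fun b => if a ≤ (b : ℕ) then 1 else 0

theorem single_chiM (n : ℕ) (a : Fin (n+1)) :
    Matrix.vecMul (Pi.single a 1) (chiM n) = chi n a := by
  rw [Matrix.single_one_vecMul]
  ext b
  simp [chiM, chi]

/-- The class of rows, in the original coordinates. -/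
def CRow (v : ℝ) (n : ℕ) (r : Fin (n+1) → ℝ) : Prop :=
  ∃ c, Row v c ∧ r = Matrix.vecMul c (chiM n)

theorem crow_A (v : ℝ) (n : ℕ) (a : ℕ) (s : ℝ) (hs : Good v s) : CRow v n (s • chi n a) := by
  by_cases ha : a < n + 1
  · exact ⟨s • Pi.single ⟨a, ha⟩ 1, Or.inl ⟨_, s, hs, rfl⟩, by rw [Matrix.smul_vecMul, single_chiM]⟩
  · refine ⟨(0:ℝ) • Pi.single 0 1, Or.inl ⟨_, 0, Or.inl rfl, rfl⟩, ?_⟩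
    ext b
    have : ¬ (a ≤ (b : ℕ)) := by omega
    simp [chi, this]

theorem crow_B (v : ℝ) (n : ℕ) (a b : ℕ) (ha : a < n + 1) (ε : ℝ) (x y : ℤ)
    (he : ε = 1 ∨ ε = -1) (hxy : Even (x - y)) :
    CRow v n ((ε * v ^ x) • chi n a - (ε * v ^ y) • chi n b) := by
  by_cases hb : b < n + 1
  · refine ⟨_, Or.inr ⟨⟨a, ha⟩, ⟨b, hb⟩, ε, x, y, he, hxy, rfl⟩, ?_⟩
    rw [Matrix.sub_vecMul, Matrix.smul_vecMul, Matrix.smul_vecMul, single_chiM, single_chiM]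
  · have : chi n b = 0 := by
      ext c
      have : ¬ (b ≤ (c : ℕ)) := by omega
      simp [chi, this]
    rw [this, smul_zero, sub_zero]
    exact crow_A v n a _ (good_unit v ε he x)

theorem det_crow (v : ℝ) (hv : 0 < v) (n : ℕ) (D : Matrix (Fin (n+1)) (Fin (n+1)) ℝ)
    (h : ∀ l, CRow v n (D l)) : Good v D.det := by
  choose c hc hD using h
  have : D = Matrix.of c * chiM n := by
    ext l b
    rw [hD l]
    rfl
  rw [this, Matrix.det_mul, det_chiM, mul_one]
  exact det_good v hv _ _ hc

theorem crow_phi (v : ℝ) (hv : 0 < v) (n : ℕ) (hn : 1 < n + 1) (g : Fin (n+1) → ℝ)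
    (hg : g ∈ Phi n v) :
    CRow v n (g - g 0 • Pi.single 0 1 - g ⟨1, hn⟩ • alphaIJ n 1 n) := by
  simp only [Phi, Set.mem_iUnion] at hg
  obtain ⟨i, j, hi, hij, hj, η, m, k, he, rfl⟩ := hg
  have e1 := qint_succ v hv k
  have e2 := qint_succ' v hv k
  have hx : v ^ (m - k) = v ^ m * v ^ (-k) := by rw [← zpow_add₀ hv.ne', sub_eq_add_neg]
  have hy : v ^ (m + k) = v ^ m * v ^ k := by rw [← zpow_add₀ hv.ne']
  by_cases h1 : i = 1
  · convert crow_A v n (j+1) (-(η * v ^ (m + k))) (good_neg hv (good_unit v η he _)) using 1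
    ext b
    subst h1
    by_cases hb : b = 0
    · subst hb
      simp [alphaIJ, alphaIJ', chi]
    · have hb' : (b : ℕ) ≠ 0 := by intro h; exact hb (Fin.ext h)
      have hb1 : 1 ≤ (b : ℕ) := by omega
      have hbn : (b : ℕ) ≤ n := by omega
      have hlt : ¬ ((b : ℕ) < 1) := by omega
      have hj1 : ¬ j < 1 := by omega
      simp only [alphaIJ, alphaIJ', chi, Pi.sub_apply, Pi.smul_apply, Pi.add_apply, smul_eq_mul,
        Pi.single_apply, if_neg hb, if_neg hb', hb1, hbn, hlt, hij, hj1, hy]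
      by_cases hbj : (b : ℕ) ≤ j
      · have h3 : ¬ j < (b : ℕ) := by omega
        have h4 : ¬ j + 1 ≤ (b : ℕ) := by omega
        simp [hbj, h3, h4]
      · have h3 : j < (b : ℕ) := by omega
        have h4 : j + 1 ≤ (b : ℕ) := by omega
        simp [hbj, h3, h4]
        rw [e2]; ring
  · have hi2 : 1 < i := by omega
    convert crow_B v n i (j+1) (by omega) η (m - k) (m + k) he ⟨-k, by ring⟩ using 1
    ext b
    by_cases hb : b = 0
    · subst hb
      have : i ≠ 0 := by omega
      simp [alphaIJ, alphaIJ', chi, this]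
    · have hb' : (b : ℕ) ≠ 0 := by intro h; exact hb (Fin.ext h)
      have hb1 : 1 ≤ (b : ℕ) := by omega
      have hbn : (b : ℕ) ≤ n := by omega
      have hni : ¬ i ≤ 1 := by omega
      simp only [alphaIJ, alphaIJ', chi, Pi.sub_apply, Pi.smul_apply, Pi.add_apply, smul_eq_mul,
        Pi.single_apply, if_neg hb, if_neg hb', hb1, hbn, hni, hi2, hy, hx]
      by_cases hbi : i ≤ (b : ℕ)
      · have h5 : ¬ (b : ℕ) < i := by omega
        by_cases hbj : (b : ℕ) ≤ j
        · have h3 : ¬ j < (b : ℕ) := by omega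
          have h4 : ¬ j + 1 ≤ (b : ℕ) := by omega
          simp only [hbi, hbj, h3, h4, h5]
          simp
          rw [e1, zpow_neg]; ring
        · have h3 : j < (b : ℕ) := by omega
          have h4 : j + 1 ≤ (b : ℕ) := by omega
          simp only [hbi, hbj, h3, h4, h5]
          simp
          have e3 : v⁻¹ * qint v k = v * qint v k + (v ^ k)⁻¹ - v ^ k := by
            rw [← zpow_neg]; linarith
          linear_combination (η * v ^ m) * e3
      · have h5 : (b : ℕ) < i := by omega
        have h3 : ¬ j < (b : ℕ) := by omega
        have h4 : ¬ j + 1 ≤ (b : ℕ) := by omega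
        simp only [hbi, h3, h4, h5]
        simp

/-- if `γ_0, …, γ_n ∈ Φ(n,v)` with `γ_p = α_0` and
`γ_q = c_k α_0 + c_{k+1}(α_1 + ⋯ + α_n)` for some `p ≠ q` and some integer `k`, then
`det(γ_0, …, γ_n) = 0` or `det(γ_0, …, γ_n) = ε v^l (v - v⁻¹)^{m-1} ∏_{k=1}^m c_{h_k}`
with `ε = ±1`, `l ∈ ℤ`, `m ≥ 1` and positive integers `h_1, …, h_m`. -/
theorem det_special_pair (n : ℕ) (hn : 2 ≤ n) (v : ℝ) (hv : 0 < v)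
    (γ : Fin (n + 1) → Fin (n + 1) → ℝ) (hγ : ∀ l, γ l ∈ Phi n v)
    (p q : Fin (n + 1)) (hpq : p ≠ q) (k : ℤ)
    (hp : γ p = (Pi.single (0 : Fin (n + 1)) 1 : Fin (n + 1) → ℝ))
    (hq : γ q = qint v k • (Pi.single (0 : Fin (n + 1)) 1 : Fin (n + 1) → ℝ)
        + qint v (k + 1) • alphaIJ n 1 n) :
    detCols γ = 0 ∨
    ∃ (ε : ℝ) (l : ℤ) (m : ℕ) (h : Fin m → ℤ),
      (ε = 1 ∨ ε = -1) ∧ 1 ≤ m ∧ (∀ k, 0 < h k) ∧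
      detCols γ = ε * v ^ l * (v - v⁻¹) ^ (m - 1) * ∏ k : Fin m, qint v (h k) := by
  have hn1 : 1 < n + 1 := by omega
  set e0 : Fin (n+1) → ℝ := Pi.single 0 1 with he0
  set al : Fin (n+1) → ℝ := alphaIJ n 1 n with hal
  have hdet : detCols γ = (Matrix.of γ).det := by
    unfold detCols
    rw [← Matrix.det_transpose]; rfl
  -- the reduced rows
  let D : Matrix (Fin (n+1)) (Fin (n+1)) ℝ := Matrix.of fun l =>
    if l = p then e0 else if l = q then al else γ l - γ l 0 • e0 - γ l ⟨1, hn1⟩ • al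
  let B' : Matrix (Fin (n+1)) (Fin (n+1)) ℝ := Matrix.of fun l =>
    if l = p then e0 else if l = q then al else γ l - γ l 0 • e0
  let B : Matrix (Fin (n+1)) (Fin (n+1)) ℝ := Matrix.of fun l =>
    if l = p then e0 else if l = q then al else γ l
  have hD : Good v D.det := by
    apply det_crow v hv
    intro l
    have hl : D l = if l = p then e0 else if l = q then al
      else γ l - γ l 0 • e0 - γ l ⟨1, hn1⟩ • al := rfl
    rw [hl]
    split_ifs with h1 h2
    · convert crow_B v n 0 1 (by omega) 1 0 0 (Or.inl rfl) (by simp) using 1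
      ext b
      by_cases hb : b = 0
      · subst hb; simp [he0, chi]
      · have hb1 : 1 ≤ (b : ℕ) := by
          have : (b : ℕ) ≠ 0 := by intro h; exact hb (Fin.ext h)
          omega
        simp [he0, chi, hb, hb1]
    · convert crow_A v n 1 1 (by simpa using good_zpow v 0) using 1
      ext b
      have : (b : ℕ) ≤ n := by omega
      simp [hal, chi, alphaIJ, this]
    · exact crow_phi v hv n hn1 _ (hγ l)
  have h1 : B'.det = D.det := by
    apply Matrix.det_eq_of_forall_row_eq_smul_add_const
      (fun l => if l = p ∨ l = q then 0 else γ l ⟨1, hn1⟩) q (by simp)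
    intro l b
    by_cases hlp : l = p
    · simp [B', D, hlp]
    · by_cases hlq : l = q
      · simp [B', D, hlq]
      · simp [B', D, hlp, hlq, hpq.symm]
  have h2 : B.det = B'.det := by
    apply Matrix.det_eq_of_forall_row_eq_smul_add_const
      (fun l => if l = p ∨ l = q then 0 else γ l 0) p (by simp)
    intro l b
    by_cases hlp : l = p
    · simp [B', B, hlp]
    · by_cases hlq : l = q
      · simp [B', B, hlq]
      · simp [B', B, hlp, hlq]
  have h3 : (Matrix.of γ).det = qint v (k + 1) * B.det := by
    have hE := Matrix.det_updateRow_smul B q (qint v (k+1)) al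
    have hB : B.updateRow q al = B := by
      ext l b
      rw [Matrix.updateRow_apply]
      split_ifs with h
      · subst h; simp [B, hpq.symm]
      · rfl
    rw [hB] at hE
    rw [← hE]
    rw [← Matrix.det_updateRow_add_smul_self (B.updateRow q (qint v (k+1) • al)) hpq.symm (qint v k)]
    congr 1
    ext l b
    rw [Matrix.updateRow_apply]
    split_ifs with h
    · subst h
      simp [hq, B, Matrix.updateRow_ne hpq]
      ring
    · rw [Matrix.updateRow_ne h]
      by_cases hlp : l = p
      · subst hlp; simp [B, hp]
      · simp [B, hlp, h]
  rw [hdet, h3, h2, h1]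
  rcases hD with h0 | ⟨ε, l, L, he, hL, hDe⟩
  · left; rw [h0, mul_zero]
  rw [hDe]
  have hprod : (L.map fun h => (v - v⁻¹) * qint v h).prod
      = (v - v⁻¹) ^ L.length * ∏ i : Fin L.length, qint v (L.get i) := by
    rw [List.prod_map_mul]
    congr 1
    · simp
    · rw [← List.prod_ofFn]
      congr 1
      apply List.ext_get <;> simp
  have hfin : ∀ (σ : ℝ) (a : ℤ), (σ = 1 ∨ σ = -1) → 0 < a → qint v (k+1) = σ * qint v a →
      ∃ (ε' : ℝ) (l' : ℤ) (m : ℕ) (h : Fin m → ℤ),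
      (ε' = 1 ∨ ε' = -1) ∧ 1 ≤ m ∧ (∀ k, 0 < h k) ∧
      qint v (k + 1) * (ε * v ^ l * (L.map fun h => (v - v⁻¹) * qint v h).prod)
        = ε' * v ^ l' * (v - v⁻¹) ^ (m - 1) * ∏ k : Fin m, qint v (h k) := by
    intro σ a hσ ha hk
    refine ⟨σ * ε, l, L.length + 1, Fin.cons a L.get, ?_, by omega, ?_, ?_⟩
    · rcases he with rfl | rfl <;> rcases hσ with rfl | rfl <;> simp
    · intro i
      refine Fin.cases ?_ ?_ i
      · simpa using ha
      · intro i; simpa using hL _ (List.get_mem L i)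
    · rw [hprod, hk, Fin.prod_univ_succ]
      simp only [Fin.cons_zero, Fin.cons_succ, Nat.add_sub_cancel]
      ring
  rcases lt_trichotomy (k + 1) 0 with hk | hk | hk
  · right
    exact hfin (-1) (-(k+1)) (Or.inr rfl) (by omega) (by rw [qint_neg]; ring)
  · left; rw [hk, qint_zero, zero_mul]
  · right
    exact hfin 1 (k+1) (Or.inl rfl) hk (by ring)
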